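/- Every graph G with maximum degree Δ ≥ 3 has star choice number at most ⌈ 2√2·Δ^(3/2) + Δ − √(8Δ) + 1 ⌉; that is, for every assignment of color lists of that size to the vertices of G there exists a star coloring of G in which every vertex receives a color from its own list. -/

import Mathlib

/-- A star coloring: a proper vertex coloring such that no path on 4 vertices is
colored with only two colors (every path on 4 vertices gets at least 3 colors). -/
def IsStarColoring {V : Type} (G : SimpleGraph V) (c : V → ℕ) : Prop :=
  (∀ u v, G.Adj u v → c u ≠ c v) ∧
  ∀ p : Fin 4 → V, Function.Injective p →
    (∀ i : Fin 3, G.Adj (p i.castSucc) (p i.succ)) →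
    3 ≤ ({c (p 0), c (p 1), c (p 2), c (p 3)} : Finset ℕ).card

/-- The star choice number: the least `k` such that for every assignment of lists of
size `k` to the vertices there is a star coloring from the lists. -/
noncomputable def starChoiceNumber {V : Type} (G : SimpleGraph V) : ℕ :=
  sInf {k | ∀ L : V → Finset ℕ, (∀ v, (L v).card = k) →
    ∃ c : V → ℕ, (∀ v, c v ∈ L v) ∧ IsStarColoring G c}

/-- `c` is a star coloring of the subgraph of `G` induced on `S`. -/
def IsStarColoringOn {V : Type} (G : SimpleGraph V) (S : Finset V) (c : V → ℕ) : Prop :=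
  (∀ u ∈ S, ∀ w ∈ S, G.Adj u w → c u ≠ c w) ∧
  ∀ p ∈ S, ∀ q ∈ S, ∀ r ∈ S, ∀ t ∈ S, G.Adj p q → G.Adj q r → G.Adj r t →
    p ≠ r → q ≠ t → p ≠ t → c p = c r → c q ≠ c t

lemma IsStarColoringOn.congr_mono {V : Type} {G : SimpleGraph V} {S T : Finset V} {c c' : V → ℕ}
    (h : IsStarColoringOn G S c) (hTS : T ⊆ S) (hc : ∀ u ∈ T, c u = c' u) :
    IsStarColoringOn G T c' := by
  refine ⟨fun u hu w hw huw => ?_, fun p hp q hq r hr t ht h₁ h₂ h₃ h₄ h₅ h₆ => ?_⟩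
  · rw [← hc u hu, ← hc w hw]
    exact h.1 u (hTS hu) w (hTS hw) huw
  · rw [← hc p hp, ← hc q hq, ← hc r hr, ← hc t ht]
    exact h.2 p (hTS hp) q (hTS hq) r (hTS hr) t (hTS ht) h₁ h₂ h₃ h₄ h₅ h₆

lemma IsStarColoringOn.isStarColoring {V : Type} [Fintype V] {G : SimpleGraph V} {c : V → ℕ}
    (h : IsStarColoringOn G Finset.univ c) : IsStarColoring G c := by
  refine ⟨fun u w huw => h.1 u (Finset.mem_univ _) w (Finset.mem_univ _) huw,
    fun p hp hadj => ?_⟩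
  have h01 : G.Adj (p 0) (p 1) := hadj 0
  have h12 : G.Adj (p 1) (p 2) := hadj 1
  have h23 : G.Adj (p 2) (p 3) := hadj 2
  have hne : ∀ i j : Fin 4, i ≠ j → p i ≠ p j := fun i j hij e => hij (hp e)
  have n01 := h.1 _ (Finset.mem_univ _) _ (Finset.mem_univ _) h01
  have n12 := h.1 _ (Finset.mem_univ _) _ (Finset.mem_univ _) h12
  have n23 := h.1 _ (Finset.mem_univ _) _ (Finset.mem_univ _) h23
  have key := h.2 _ (Finset.mem_univ _) _ (Finset.mem_univ _) _ (Finset.mem_univ _) _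
    (Finset.mem_univ _) h01 h12 h23 (hne 0 2 (by decide)) (hne 1 3 (by decide))
    (hne 0 3 (by decide))
  refine Nat.succ_le_of_lt (Finset.two_lt_card.2 ?_)
  by_cases h02 : c (p 0) = c (p 2)
  · exact ⟨c (p 0), by simp, c (p 1), by simp, c (p 3), by simp, n01,
      fun e => n23 (h02.symm.trans e), key h02⟩
  · exact ⟨c (p 0), by simp, c (p 1), by simp, c (p 2), by simp, n01, h02, n12⟩

/-- If an extension of a star coloring of `S` to a new vertex `v` fails, then `v` has the color of
a neighbor, or it is an end vertex or an inner vertex of a bicolored path on 4 vertices. -/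
lemma IsStarColoringOn.exists_conflict {V : Type} [DecidableEq V] {G : SimpleGraph V}
    {S : Finset V} {c : V → ℕ} {v : V} (h : IsStarColoringOn G S c)
    (hv : ¬ IsStarColoringOn G (insert v S) c) :
    (∃ u ∈ S, G.Adj v u ∧ c v = c u) ∨
    (∃ q ∈ S, ∃ r ∈ S, ∃ t ∈ S, G.Adj v q ∧ G.Adj q r ∧ G.Adj r t ∧ r ≠ v ∧ t ≠ q ∧
      c v = c r ∧ c t = c q) ∨
    (∃ q ∈ S, ∃ t ∈ S, ∃ r ∈ S, G.Adj v q ∧ G.Adj v t ∧ G.Adj q r ∧ t ≠ q ∧ r ≠ v ∧ r ≠ t ∧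
      c v = c r ∧ c t = c q) := by
  by_contra hcon
  push Not at hcon
  obtain ⟨k₁, k₂, k₃⟩ := hcon
  have hS : ∀ u ∈ insert v S, u ≠ v → u ∈ S := fun u hu huv => Finset.mem_of_mem_insert_of_ne hu huv
  refine hv ⟨fun u hu w hw huw e => ?_, fun p hp q hq r hr t ht pq qr rt pr qt pt e₁ e₂ => ?_⟩
  · by_cases huv : u = v
    · subst huv
      exact k₁ w (hS w hw huw.ne') huw e
    · by_cases hwv : w = v
      · subst hwv
        exact k₁ u (hS u hu huv) huw.symm e.symm
      · exact h.1 u (hS u hu huv) w (hS w hw hwv) huw e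
  · by_cases hpv : p = v
    · subst hpv
      exact k₂ q (hS q hq pq.ne') r (hS r hr pr.symm) t (hS t ht pt.symm) pq qr rt pr.symm qt.symm
        e₁ e₂.symm
    by_cases hqv : q = v
    · subst hqv
      exact k₃ r (hS r hr qr.ne') p (hS p hp hpv) t (hS t ht qt.symm) qr pq.symm rt pr qt.symm
        pt.symm e₂ e₁
    by_cases hrv : r = v
    · subst hrv
      exact k₃ q (hS q hq hqv) t (hS t ht rt.ne') p (hS p hp hpv) qr.symm rt pq.symm qt.symm pr
        pt e₁.symm e₂.symm
    by_cases htv : t = v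
    · subst htv
      exact k₂ r (hS r hr hrv) q (hS q hq hqv) p (hS p hp hpv) rt.symm qr.symm pq.symm qt pr
        e₂.symm e₁
    exact h.2 p (hS p hp hpv) q (hS q hq hqv) r (hS r hr hrv) t (hS t ht htv) pq qr rt pr qt pt
      e₁ e₂

open Classical in
/-- The star colorings of `G[S]` from the lists `L`, extended by `0` outside `S`. -/
noncomputable def listStarColorings {V : Type} [Fintype V] (G : SimpleGraph V)
    (L : V → Finset ℕ) (S : Finset V) : Finset (V → ℕ) :=
  {c ∈ Fintype.piFinset fun v => if v ∈ S then L v else {0} | IsStarColoringOn G S c}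

lemma mem_listStarColorings {V : Type} [Fintype V] {G : SimpleGraph V}
    {L : V → Finset ℕ} {S : Finset V} {c : V → ℕ} :
    c ∈ listStarColorings G L S ↔
      (∀ v ∈ S, c v ∈ L v) ∧ (∀ v ∉ S, c v = 0) ∧ IsStarColoringOn G S c := by
  classical
  simp only [listStarColorings, Finset.mem_filter, Fintype.mem_piFinset, ← and_assoc]
  refine and_congr_left fun _ => ⟨fun h => ⟨fun v hv => ?_, fun v hv => ?_⟩, fun h v => ?_⟩
  · simpa [hv] using h v
  · simpa [hv] using h v
  · by_cases hv : v ∈ S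
    · simpa [hv] using h.1 v hv
    · simpa [hv] using h.2 v hv

lemma card_biUnion_le_mul_real {α ι : Type*} [DecidableEq α] (s : Finset ι) (f : ι → Finset α)
    {n m : ℝ} (hm : 0 ≤ m) (hs : (s.card : ℝ) ≤ n) (hf : ∀ i ∈ s, ((f i).card : ℝ) ≤ m) :
    ((s.biUnion f).card : ℝ) ≤ n * m := by
  calc ((s.biUnion f).card : ℝ) ≤ ∑ i ∈ s, ((f i).card : ℝ) := by
        exact_mod_cast Finset.card_biUnion_le
    _ ≤ s.card * m := by simpa using Finset.sum_le_card_nsmul s _ m hf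
    _ ≤ n * m := by gcongr

lemma card_filter_eq_le_card_listStarColorings {V : Type} [Fintype V] (G : SimpleGraph V)
    (L : V → Finset ℕ) (S : Finset V) (A : Finset ℕ) (u : V) :
    {z ∈ listStarColorings G L S ×ˢ A | z.2 = z.1 u}.card ≤ (listStarColorings G L S).card := by
  refine Finset.card_le_card_of_injOn Prod.fst (fun z hz => ?_) ?_
  · simp only [Finset.coe_filter, Finset.mem_product, Set.mem_ofPred_eq] at hz
    exact hz.1.1
  · rintro ⟨c, x⟩ hz ⟨c', x'⟩ hz' rfl
    simp_all

lemma card_filter_eq_eq_le_card_listStarColorings {V : Type} [Fintype V] [DecidableEq V]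
    (G : SimpleGraph V) (L : V → Finset ℕ) (S : Finset V) (A : Finset ℕ) {q r t : V}
    (hr : r ≠ t) (hq : q ≠ t) :
    {z ∈ listStarColorings G L S ×ˢ A | z.2 = z.1 r ∧ z.1 t = z.1 q}.card ≤
      (listStarColorings G L (S.erase t)).card := by
  refine Finset.card_le_card_of_injOn (fun z => Function.update z.1 t 0) (fun z hz => ?_) ?_
  · simp only [Finset.coe_filter, Finset.mem_product, Set.mem_ofPred_eq,
      mem_listStarColorings] at hz
    obtain ⟨⟨⟨h₁, h₂, h₃⟩, -⟩, -⟩ := hz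
    rw [Finset.mem_coe, mem_listStarColorings]
    dsimp only
    refine ⟨fun w hw => ?_, fun w hw => ?_, h₃.congr_mono (Finset.erase_subset _ _) fun w hw => ?_⟩
    · rw [Function.update_of_ne (Finset.ne_of_mem_erase hw)]
      exact h₁ w (Finset.mem_of_mem_erase hw)
    · by_cases hwt : w = t
      · simp [hwt]
      · rw [Function.update_of_ne hwt]
        exact h₂ w fun hwS => hw (Finset.mem_erase.2 ⟨hwt, hwS⟩)
    · rw [Function.update_of_ne (Finset.ne_of_mem_erase hw)]
  · rintro ⟨c, x⟩ hz ⟨c', x'⟩ hz' e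
    simp only [Finset.coe_filter, Set.mem_ofPred_eq] at hz hz' e
    have hoff : ∀ w, w ≠ t → c w = c' w := fun w hw => by
      simpa [Function.update_of_ne hw] using congrFun e w
    have hcc : c = c' := by
      funext w
      by_cases hw : w = t
      · rw [hw, hz.2.2, hz'.2.2, hoff q hq]
      · exact hoff w hw
    rw [Prod.mk.injEq]
    exact ⟨hcc, by rw [hz.2.1, hz'.2.1, hoff r hr]⟩

lemma card_filter_isStarColoringOn_update_le {V : Type} [Fintype V] [DecidableEq V]
    (G : SimpleGraph V) (L : V → Finset ℕ) {S : Finset V} {v : V} (hv : v ∉ S)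
    [DecidablePred fun z : (V → ℕ) × ℕ =>
      IsStarColoringOn G (insert v S) (Function.update z.1 v z.2)] :
    {z ∈ listStarColorings G L S ×ˢ L v |
      IsStarColoringOn G (insert v S) (Function.update z.1 v z.2)}.card ≤
      (listStarColorings G L (insert v S)).card := by
  refine Finset.card_le_card_of_injOn (fun z => Function.update z.1 v z.2) (fun z hz => ?_) ?_
  · simp only [Finset.coe_filter, Finset.mem_product, Set.mem_ofPred_eq,
      mem_listStarColorings] at hz
    obtain ⟨⟨⟨h₁, h₂, -⟩, hx⟩, h₃⟩ := hz
    rw [Finset.mem_coe, mem_listStarColorings]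
    dsimp only
    refine ⟨fun w hw => ?_, fun w hw => ?_, h₃⟩
    · by_cases hwv : w = v
      · subst hwv
        simpa using hx
      · rw [Function.update_of_ne hwv]
        exact h₁ w (Finset.mem_of_mem_insert_of_ne hw hwv)
    · rw [Finset.mem_insert, not_or] at hw
      rw [Function.update_of_ne hw.1]
      exact h₂ w hw.2
  · rintro ⟨c, x⟩ hz ⟨c', x'⟩ hz' e
    simp only [Finset.coe_filter, Finset.mem_product, Set.mem_ofPred_eq,
      mem_listStarColorings] at hz hz' e
    rw [Prod.mk.injEq]
    refine ⟨funext fun w => ?_, by simpa using congrFun e v⟩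
    by_cases hw : w = v
    · rw [hw, hz.1.1.2.1 v hv, hz'.1.1.2.1 v hv]
    · simpa [Function.update_of_ne hw] using congrFun e w

/-- Each new vertex multiplies the number of star colorings from the lists by at least `β`. -/
lemma mul_card_listStarColorings_le {V : Type} [Fintype V] [DecidableEq V] (G : SimpleGraph V)
    [DecidableRel G.Adj] (L : V → Finset ℕ) {D β : ℝ} {k : ℕ} (hD : 1 ≤ D) (hβ : 0 < β)
    (hdeg : ∀ v, (G.degree v : ℝ) ≤ D) (hL : ∀ v, (L v).card = k)
    (hk : β + D + 2 * (D * (D - 1) ^ 2) / β ≤ k) (S : Finset V) :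
    ∀ v ∉ S, β * (listStarColorings G L S).card ≤ (listStarColorings G L (insert v S)).card := by
  classical
  induction S using Finset.strongInduction with
  | H S ih =>
  intro v hv
  set N : ℝ := ((listStarColorings G L S).card : ℝ) with hN
  have hN0 : 0 ≤ N := Nat.cast_nonneg _
  set P := listStarColorings G L S ×ˢ L v with hP
  let f : (V → ℕ) × ℕ → V → ℕ := fun z => Function.update z.1 v z.2
  let B : V → V → V → Finset ((V → ℕ) × ℕ) := fun q r t =>
    {z ∈ P | (t ∈ S ∧ r ≠ t ∧ q ≠ t) ∧ z.2 = z.1 r ∧ z.1 t = z.1 q}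
  have hB : ∀ q r t, ((B q r t).card : ℝ) ≤ N / β := by
    intro q r t
    by_cases hc : t ∈ S ∧ r ≠ t ∧ q ≠ t
    · have h₁ := card_filter_eq_eq_le_card_listStarColorings G L S (L v) hc.2.1 hc.2.2
      have h₂ := ih (S.erase t) (Finset.erase_ssubset hc.1) t (Finset.notMem_erase t S)
      rw [Finset.insert_erase hc.1] at h₂
      rw [le_div_iff₀ hβ, mul_comm]
      refine le_trans (mul_le_mul_of_nonneg_left ?_ hβ.le) h₂
      simpa only [B, hc, ne_eq, not_false_eq_true, and_self, true_and, Nat.cast_le] using h₁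
    · simp only [B, hc, false_and, Finset.filter_false, Finset.card_empty, Nat.cast_zero]
      positivity
  let B₁ := (G.neighborFinset v).biUnion fun u => {z ∈ P | z.2 = z.1 u}
  let B₂ := (G.neighborFinset v).biUnion fun q => ((G.neighborFinset q).erase v).biUnion fun r =>
    ((G.neighborFinset r).erase q).biUnion fun t => B q r t
  let B₃ := (G.neighborFinset v).biUnion fun q => ((G.neighborFinset v).erase q).biUnion fun t =>
    ((G.neighborFinset q).erase v).biUnion fun r => B q r t
  have hD0 : 0 ≤ D - 1 := by linarith
  have hQ : 0 ≤ N / β := by positivity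
  have hdeg' : ∀ u, ((G.neighborFinset u).card : ℝ) ≤ D := fun u => by simpa using hdeg u
  have herase : ∀ u w, G.Adj u w → (((G.neighborFinset u).erase w).card : ℝ) ≤ D - 1 := by
    intro u w huw
    have h₁ := Finset.card_erase_add_one ((G.mem_neighborFinset u w).2 huw)
    have h₂ : (((G.neighborFinset u).erase w).card : ℝ) + 1 = (G.neighborFinset u).card := by
      exact_mod_cast h₁
    linarith [hdeg' u]
  have c₁ : (B₁.card : ℝ) ≤ D * N :=
    card_biUnion_le_mul_real _ _ hN0 (hdeg' v) fun u _ =>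
      Nat.cast_le.2 (card_filter_eq_le_card_listStarColorings G L S (L v) u)
  have c₂ : (B₂.card : ℝ) ≤ D * ((D - 1) * ((D - 1) * (N / β))) := by
    refine card_biUnion_le_mul_real _ _ (by positivity) (hdeg' v) fun q hq => ?_
    rw [G.mem_neighborFinset] at hq
    refine card_biUnion_le_mul_real _ _ (by positivity) (herase q v hq.symm) fun r hr => ?_
    rw [Finset.mem_erase, G.mem_neighborFinset] at hr
    exact card_biUnion_le_mul_real _ _ hQ (herase r q hr.2.symm) fun t _ => hB q r t
  have c₃ : (B₃.card : ℝ) ≤ D * ((D - 1) * ((D - 1) * (N / β))) := by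
    refine card_biUnion_le_mul_real _ _ (by positivity) (hdeg' v) fun q hq => ?_
    rw [G.mem_neighborFinset] at hq
    refine card_biUnion_le_mul_real _ _ (by positivity) (herase v q hq) fun t _ => ?_
    exact card_biUnion_le_mul_real _ _ hQ (herase q v hq.symm) fun r _ => hB q r t
  have hsub : {z ∈ P | ¬ IsStarColoringOn G (insert v S) (f z)} ⊆ B₁ ∪ (B₂ ∪ B₃) := by
    intro z hz
    rw [Finset.mem_filter] at hz
    obtain ⟨hzP, hz⟩ := hz
    have hzS := (mem_listStarColorings.1 (Finset.mem_product.1 hzP).1).2.2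
    have hne : ∀ u ∈ S, u ≠ v := fun u hu e => hv (e ▸ hu)
    have hfz : ∀ u ∈ S, f z u = z.1 u := fun u hu => Function.update_of_ne (hne u hu) _ _
    have hfv : f z v = z.2 := Function.update_self _ _ _
    have hfS : IsStarColoringOn G S (f z) :=
      hzS.congr_mono subset_rfl fun u hu => (hfz u hu).symm
    simp only [Finset.mem_union]
    rcases hfS.exists_conflict hz with ⟨u, hu, a, e⟩ |
      ⟨q, hq, r, hr, t, ht, a₁, a₂, a₃, n₁, n₂, e₁, e₂⟩ |
      ⟨q, hq, t, ht, r, hr, a₁, a₂, a₃, n₁, n₂, n₃, e₁, e₂⟩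
    · left
      rw [hfv, hfz u hu] at e
      simp only [B₁, Finset.mem_biUnion, Finset.mem_filter, G.mem_neighborFinset]
      exact ⟨u, a, hzP, e⟩
    · right; left
      rw [hfv, hfz r hr] at e₁
      rw [hfz t ht, hfz q hq] at e₂
      simp only [B₂, B, Finset.mem_biUnion, Finset.mem_filter, Finset.mem_erase,
        G.mem_neighborFinset]
      exact ⟨q, a₁, r, ⟨n₁, a₂⟩, t, ⟨n₂, a₃⟩, hzP, ⟨ht, a₃.ne, n₂.symm⟩, e₁, e₂⟩
    · right; right
      rw [hfv, hfz r hr] at e₁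
      rw [hfz t ht, hfz q hq] at e₂
      simp only [B₃, B, Finset.mem_biUnion, Finset.mem_filter, Finset.mem_erase,
        G.mem_neighborFinset]
      exact ⟨q, a₁, t, ⟨n₁, a₂⟩, r, ⟨n₂, a₃⟩, hzP, ⟨ht, n₃, n₁.symm⟩, e₁, e₂⟩
  have hbad : ({z ∈ P | ¬ IsStarColoringOn G (insert v S) (f z)}.card : ℝ) ≤
      B₁.card + (B₂.card + B₃.card) := by
    exact_mod_cast (Finset.card_le_card hsub).trans ((Finset.card_union_le _ _).trans
      (Nat.add_le_add_left (Finset.card_union_le _ _) _))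
  have hgood : ({z ∈ P | IsStarColoringOn G (insert v S) (f z)}.card : ℝ) ≤
      (listStarColorings G L (insert v S)).card := by
    exact_mod_cast card_filter_isStarColoringOn_update_le G L hv
  have htot : ({z ∈ P | IsStarColoringOn G (insert v S) (f z)}.card : ℝ) +
      {z ∈ P | ¬ IsStarColoringOn G (insert v S) (f z)}.card = N * k := by
    rw [hN, ← hL v, ← Nat.cast_add, ← Nat.cast_mul, Finset.card_filter_add_card_filter_not, hP,
      Finset.card_product]
  have hNk := mul_le_mul_of_nonneg_left hk hN0
  have hexp : N * (β + D + 2 * (D * (D - 1) ^ 2) / β) =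
      β * N + D * N + 2 * (D * ((D - 1) * ((D - 1) * (N / β)))) := by
    field_simp
  linarith

lemma exists_isStarColoring_of_le {V : Type} [Fintype V] (G : SimpleGraph V)
    [DecidableRel G.Adj] (L : V → Finset ℕ) {D β : ℝ} {k : ℕ} (hD : 1 ≤ D) (hβ : 0 < β)
    (hdeg : ∀ v, (G.degree v : ℝ) ≤ D) (hL : ∀ v, (L v).card = k)
    (hk : β + D + 2 * (D * (D - 1) ^ 2) / β ≤ k) :
    ∃ c : V → ℕ, (∀ v, c v ∈ L v) ∧ IsStarColoring G c := by
  classical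
  have hpos : ∀ S : Finset V, 0 < ((listStarColorings G L S).card : ℝ) := by
    intro S
    induction S using Finset.induction_on with
    | empty =>
      have h : (fun _ => 0) ∈ listStarColorings G L ∅ := by
        simp [mem_listStarColorings, IsStarColoringOn]
      exact_mod_cast Finset.card_pos.2 ⟨_, h⟩
    | insert v S hv ih =>
      exact (mul_pos hβ ih).trans_le (mul_card_listStarColorings_le G L hD hβ hdeg hL hk S v hv)
  obtain ⟨c, hc⟩ := Finset.card_pos.1 (Nat.cast_pos.1 (hpos Finset.univ))
  obtain ⟨h₁, -, h₂⟩ := mem_listStarColorings.1 hc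
  exact ⟨c, fun v => h₁ v (Finset.mem_univ v), h₂.isStarColoring⟩

theorem stmt19 {V : Type} [Fintype V] (G : SimpleGraph V) [DecidableRel G.Adj]
    (Δ : ℕ) (hΔ : G.maxDegree = Δ) (h3 : 3 ≤ Δ) :
    starChoiceNumber G ≤
      ⌈2 * Real.sqrt 2 * (Δ : ℝ) ^ ((3 : ℝ) / 2) + (Δ : ℝ) - Real.sqrt (8 * (Δ : ℝ)) + 1⌉₊ := by
  have hD : (3 : ℝ) ≤ Δ := by exact_mod_cast h3
  have hD0 : (0 : ℝ) ≤ Δ := by linarith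
  have hs2 : Real.sqrt 2 ^ 2 = 2 := Real.sq_sqrt (by norm_num)
  have hsD : Real.sqrt Δ ^ 2 = Δ := Real.sq_sqrt hD0
  have hp2 : 0 < Real.sqrt 2 := Real.sqrt_pos.2 (by norm_num)
  have hpD : 0 < Real.sqrt Δ := Real.sqrt_pos.2 (by linarith)
  have h8 : Real.sqrt (8 * (Δ : ℝ)) = 2 * Real.sqrt 2 * Real.sqrt Δ := by
    rw [show (8 : ℝ) * Δ = 2 ^ 2 * 2 * Δ by ring, Real.sqrt_mul (by norm_num),
      Real.sqrt_mul (by norm_num), Real.sqrt_sq (by norm_num)]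
  have hpow : (Δ : ℝ) ^ ((3 : ℝ) / 2) = Δ * Real.sqrt Δ := by
    rw [show (3 : ℝ) / 2 = 1 + 1 / 2 by norm_num, Real.rpow_add (by linarith), Real.rpow_one,
      Real.sqrt_eq_rpow]
  have hβ : 0 < Real.sqrt 2 * Real.sqrt Δ * (Δ - 1) :=
    mul_pos (mul_pos hp2 hpD) (by linarith)
  refine Nat.sInf_le fun L hL => exists_isStarColoring_of_le G L (D := Δ) (by linarith) hβ
    (fun v => by exact_mod_cast hΔ ▸ G.degree_le_maxDegree v) hL ?_
  refine le_trans ?_ (Nat.le_ceil _)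
  have hdiv : 2 * ((Δ : ℝ) * (Δ - 1) ^ 2) / (Real.sqrt 2 * Real.sqrt Δ * (Δ - 1)) =
      Real.sqrt 2 * Real.sqrt Δ * (Δ - 1) := by
    rw [div_eq_iff hβ.ne']
    calc 2 * ((Δ : ℝ) * (Δ - 1) ^ 2)
        = Real.sqrt 2 ^ 2 * (Real.sqrt Δ ^ 2 * (Δ - 1) ^ 2) := by rw [hs2, hsD]
      _ = _ := by ring
  rw [hdiv, h8, hpow]
  linarith
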